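/- The standard (1,1) diagram with four-tuple (p,q,r,s) = (9, 2, 0, 4) has exactly two inconsistent rainbow arcs (one around each basepoint), yet the union of the lifts β̃_s in the universal cover contains four inconsistent arcs. In particular, this diagram is not virtually almost coherent (equivalently, not strongly almost coherent), so having exactly two inconsistent rainbow arcs does not imply strong almost coherence. (The counterexample K(9,2,0,4) of Figure 4 of the paper.) -/

import Mathlib

/-!
Common combinatorial framework for standard (1,1) diagrams in Rasmussen standard
form, their lifts to the universal cover of the torus, and the combinatorial knot
Floer chain complexes they define.
-/

namespace OneOneKnot

open scoped Classical

noncomputable section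

/-- A state in the traversal of the lifts of the `β` curve of a standard (1,1) diagram
to the universal cover `ℝ²` of the torus.  `pos` is the position coordinate of an
intersection point of `β` with a lift of `α`; `up` records whether `β` crosses that
lift of `α` upwards (with respect to the reference orientation of `β`); `top` records
whether `pos` is measured as a top-edge or a bottom-edge coordinate of the
corresponding fundamental rectangle; `ht` is the index of the lift of `α` (the line
`y = ht`). -/
structure CState where
  pos : ℤ
  up : Bool
  top : Bool
  ht : ℤ

/-- The data of a standard (1,1) diagram in Rasmussen standard form, encoded by a
four-tuple `(p, q, r, s)` with `q, r ≥ 0`, `2q + r ≤ p` and `0 ≤ s < p`. -/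
structure StdDiagram where
  p : ℕ
  q : ℕ
  r : ℕ
  s : ℕ
  hp : 0 < p
  h2qr : 2 * q + r ≤ p
  hs : s < p

namespace StdDiagram

variable (D : StdDiagram)

def pz : ℤ := D.p
def qz : ℤ := D.q
def rz : ℤ := D.r
def sz : ℤ := D.s

/-- One step forward along (a lift of) `β`, with respect to a reference orientation of
`β`.  This is Algorithm 1 of the paper: rainbow arcs occupy top-edge positions
`r, …, r + 2q - 1` and bottom-edge positions `0, …, 2q - 1` (mod `p`), the `i`-th
point of the top edge is identified with the `(i+s)`-th point of the bottom edge, and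
`ht` records the line `y = ht` of the universal cover on which the point lies. -/
def step (σ : CState) : CState :=
  let m := σ.pos % D.pz
  if σ.top then
    if σ.up then ⟨σ.pos + D.sz, σ.up, false, σ.ht⟩
    else if m ≤ D.rz - 1 then ⟨σ.pos + 2 * D.qz, σ.up, false, σ.ht - 1⟩
    else if m ≤ D.rz + 2 * D.qz - 1 then
      ⟨2 * D.rz + 2 * D.qz - 1 - 2 * m + σ.pos, true, true, σ.ht⟩
    else ⟨σ.pos, σ.up, false, σ.ht - 1⟩
  else
    if σ.up = false then ⟨σ.pos - D.sz, σ.up, true, σ.ht⟩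
    else if m ≤ 2 * D.qz - 1 then ⟨2 * D.qz - 1 - 2 * m + σ.pos, false, false, σ.ht⟩
    else if m ≤ D.rz + 2 * D.qz - 1 then ⟨σ.pos - 2 * D.qz, σ.up, true, σ.ht + 1⟩
    else ⟨σ.pos, σ.up, true, σ.ht + 1⟩

/-- One step backward along `β` (the inverse of `step`). -/
def stepB (σ : CState) : CState :=
  let m := σ.pos % D.pz
  if σ.top then
    if σ.up then
      if D.rz ≤ m ∧ m ≤ D.rz + 2 * D.qz - 1 then
        ⟨2 * D.rz + 2 * D.qz - 1 - 2 * m + σ.pos, false, true, σ.ht⟩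
      else if m ≤ D.rz - 1 then ⟨σ.pos + 2 * D.qz, true, false, σ.ht - 1⟩
      else ⟨σ.pos, true, false, σ.ht - 1⟩
    else ⟨σ.pos + D.sz, false, false, σ.ht⟩
  else
    if σ.up then ⟨σ.pos - D.sz, true, true, σ.ht⟩
    else
      if m ≤ 2 * D.qz - 1 then ⟨2 * D.qz - 1 - 2 * m + σ.pos, true, false, σ.ht⟩
      else if m ≤ 2 * D.qz + D.rz - 1 then ⟨σ.pos - 2 * D.qz, false, true, σ.ht + 1⟩
      else ⟨σ.pos, false, true, σ.ht + 1⟩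

/-- Reference starting state: the intersection point with top-edge coordinate `0`
on the line `y = 0`. -/
def start0 : CState := ⟨0, false, true, 0⟩

/-- `β` is a single closed curve: its traversal passes through all `p`
intersection points with `α`. -/
def Connected : Prop :=
  ∀ k : ℕ, k < D.p → ∃ n : ℕ,
    ((D.step)^[n] start0).top = true ∧ ((D.step)^[n] start0).pos % D.pz = (k : ℤ)

/-- `β` crosses the intersection point with top-edge coordinate `≡ k (mod p)`
upwards, with respect to the reference orientation of `β`. -/
def UpAt (k : ℤ) : Prop :=
  ∃ n : ℕ, ((D.step)^[n] start0).top = true ∧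
    ((D.step)^[n] start0).pos % D.pz = k % D.pz ∧ ((D.step)^[n] start0).up = true

/-- The algebraic intersection number `α · β` computed with the reference
orientation of `β` (and `α` oriented from left to right). -/
def algInt : ℤ := ∑ k ∈ Finset.range D.p, (if D.UpAt (k : ℤ) then (1 : ℤ) else -1)

/-- One step forward along `β` for the orientation of `β` normalised so that
`α · β > 0`. -/
def fstep (σ : CState) : CState := if 0 < D.algInt then D.step σ else D.stepB σ

/-- With the normalised orientation, `β` crosses `α` upwards at the given state. -/
def TrueUp (σ : CState) : Prop := (0 < D.algInt ↔ σ.up = true)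

/-- With the normalised orientation, `β` crosses the intersection point with
top-edge coordinate `≡ k (mod p)` upwards. -/
def TrueUpPt (k : ℤ) : Prop := (0 < D.algInt ↔ D.UpAt k)

/-- The canonical state sitting at the intersection point `k` on the line `y = 0`
(of the chosen lift `α̃` of `α`). -/
def spt (k : ℕ) : CState := ⟨(k : ℤ), if D.UpAt (k : ℤ) then true else false, true, 0⟩

/-- The state is an intersection point of `β̃` with the line `y = 0`
(recorded with its canonical top-edge coordinate). -/
def IsCross0 (σ : CState) : Prop := σ.top = true ∧ σ.ht = 0

/-- The portion of `β̃` after `σ` returns to the line `y = 0`; that is, `σ` is the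
starting point of a compact arc cut off by `α̃` rather than of a ray. -/
def Returns0 (σ : CState) : Prop := ∃ n : ℕ, 1 ≤ n ∧ IsCross0 ((D.fstep)^[n] σ)

/-- Number of `fstep`-moves until the next intersection with the line `y = 0`. -/
def ret0Steps (σ : CState) : ℕ := sInf {n : ℕ | 1 ≤ n ∧ IsCross0 ((D.fstep)^[n] σ)}

/-- The next intersection point of `β̃` with the line `y = 0` after `σ`. -/
def nxt0 (σ : CState) : CState := (D.fstep)^[D.ret0Steps σ] σ

/-- The label (downstairs intersection point) of a state. -/
def lab (σ : CState) : ℤ := σ.pos % D.pz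

/-- The compact arc of `β̃` starting at the intersection point `k` of the line
`y = 0` is oriented rightward (for the normalised orientation of `β`). -/
def ArcRight (k : ℕ) : Prop := (k : ℤ) < (D.nxt0 (D.spt k)).pos

/-- Starting points of the compact arcs in the upper half-plane cut off by `α̃`
from the union of the lifts `β̃ₛ`. -/
def UpperStarts : Finset ℕ :=
  (Finset.range D.p).filter fun k => D.Returns0 (D.spt k) ∧ D.TrueUp (D.spt k)

/-- Starting points of the compact arcs in the lower half-plane. -/
def LowerStarts : Finset ℕ :=
  (Finset.range D.p).filter fun k => D.Returns0 (D.spt k) ∧ ¬ D.TrueUp (D.spt k)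

/-- The number of compact arcs in the upper half-plane with orientation `b`
(`true` = rightward, `false` = leftward). -/
def uCnt (b : Bool) : ℕ := (D.UpperStarts.filter fun k => D.ArcRight k ↔ b = true).card

/-- The number of compact arcs in the lower half-plane with orientation `b`. -/
def lCnt (b : Bool) : ℕ := (D.LowerStarts.filter fun k => D.ArcRight k ↔ b = true).card

/-- Definition 3.2: the standard diagram is *virtually almost coherent* if, for an
admissible choice of inconsistent direction in each half-plane (the inconsistent
direction must be carried by at most as many arcs as the other direction), the
union of the lifts `β̃ₛ` contains exactly two inconsistent arcs. -/
def VirtuallyAlmostCoherent : Prop :=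
  ∃ dU dL : Bool,
    D.uCnt dU ≤ D.uCnt (!dU) ∧ D.lCnt dL ≤ D.lCnt (!dL) ∧ D.uCnt dU + D.lCnt dL = 2

/-- `k` is the starting point of one of the two inconsistent arcs, for the choice
`(dU, dL)` of inconsistent directions in the upper and lower half-planes. -/
def InconsCoverArc (dU dL : Bool) (k : ℕ) : Prop :=
  (k ∈ D.UpperStarts ∧ (D.ArcRight k ↔ dU = true)) ∨
  (k ∈ D.LowerStarts ∧ (D.ArcRight k ↔ dL = true))

/-! ### Rainbow arcs of the diagram downstairs -/

/-- The rainbow arcs of the standard diagram: `(true, i)` with `r ≤ i < r + q` is the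
rainbow arc attached to the top edge with feet `i` and `2r + 2q - 1 - i`; `(false, j)`
with `j < q` is the rainbow arc attached to the bottom edge with feet `j` and
`2q - 1 - j`.  The two families are the rainbow arcs around the two basepoints. -/
def rainbowArcs : Finset (Bool × ℕ) :=
  ((Finset.Ico D.r (D.r + D.q)).image fun i => ((true : Bool), i)) ∪
    ((Finset.range D.q).image fun j => ((false : Bool), j))

/-- The two endpoints of a rainbow arc, as intersection points of `α ∩ β` recorded
by their top-edge coordinates in `ZMod p`. -/
def rEnds (a : Bool × ℕ) : Finset (ZMod D.p) :=
  if a.1 then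
    {((a.2 : ℤ) : ZMod D.p), ((2 * D.rz + 2 * D.qz - 1 - (a.2 : ℤ) : ℤ) : ZMod D.p)}
  else
    {(((a.2 : ℤ) - D.sz : ℤ) : ZMod D.p), ((2 * D.qz - 1 - (a.2 : ℤ) - D.sz : ℤ) : ZMod D.p)}

/-- A rainbow arc is oriented rightward (with the normalised orientation of `β`):
a top-edge rainbow arc is traversed starting from the endpoint where `β` crosses `α`
downwards, a bottom-edge one from the endpoint where `β` crosses `α` upwards. -/
def rOrientRight (a : Bool × ℕ) : Prop :=
  if a.1 then ¬ D.TrueUpPt (a.2 : ℤ) else D.TrueUpPt ((a.2 : ℤ) - D.sz)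

/-- The number of rainbow arcs in the family `f` (`true` = attached to the top edge)
with orientation `b` (`true` = rightward). -/
def famCnt (f : Bool) (b : Bool) : ℕ :=
  (D.rainbowArcs.filter fun a => a.1 = f ∧ (D.rOrientRight a ↔ b = true)).card

/-- `a` is an inconsistent rainbow arc for the choice `(dT, dB)` of inconsistent
directions for the two families. -/
def InconsArc (dT dB : Bool) (a : Bool × ℕ) : Prop :=
  a ∈ D.rainbowArcs ∧ (D.rOrientRight a ↔ (if a.1 then dT else dB) = true)

/-- Two rainbow arcs share a common endpoint. -/
def ShareEnd (a b : Bool × ℕ) : Prop := ((D.rEnds a) ∩ (D.rEnds b)).Nonempty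

/-- Two rainbow arcs are connected to each other by two other rainbow arcs. -/
def ConnectedByTwo (a1 a2 : Bool × ℕ) : Prop :=
  ∃ b1 b2 : Bool × ℕ, b1 ∈ D.rainbowArcs ∧ b2 ∈ D.rainbowArcs ∧
    b1 ≠ a1 ∧ b1 ≠ a2 ∧ b2 ≠ a1 ∧ b2 ≠ a2 ∧ b1 ≠ b2 ∧
    D.ShareEnd a1 b1 ∧ D.ShareEnd b1 b2 ∧ D.ShareEnd b2 a2

/-- Definition 1.2: the standard diagram is *strongly almost coherent* if, for an
admissible choice of inconsistent directions, there are exactly two inconsistent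
rainbow arcs, and either they share a common endpoint, or they are connected to each
other by two other rainbow arcs. -/
def StronglyAlmostCoherent : Prop :=
  ∃ dT dB : Bool,
    D.famCnt true dT ≤ D.famCnt true (!dT) ∧ D.famCnt false dB ≤ D.famCnt false (!dB) ∧
    ∃ a1 a2 : Bool × ℕ, a1 ≠ a2 ∧ (∀ a, D.InconsArc dT dB a ↔ (a = a1 ∨ a = a2)) ∧
      (D.ShareEnd a1 a2 ∨ D.ConnectedByTwo a1 a2)

/-! ### Spin^c classes of intersection points -/

/-- The point `l` is reached from the point `k` by travelling forward along the lift
`β̃` through (the lift at height `0` of) `k`, meeting it on the line `y = 0`. -/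
def Reach (k l : ℕ) : Prop :=
  ∃ n : ℕ, IsCross0 ((D.fstep)^[n] (D.spt k)) ∧
    ((D.fstep)^[n] (D.spt k)).pos % D.pz = (l : ℤ)

/-- Two intersection points are in the same class (i.e. they induce the same
spin^c structure): some lift of `β` meeting the line `y = 0` passes through lifts
of both of them on that line. -/
def SameClass (k l : ℕ) : Prop := D.Reach k l ∨ D.Reach l k

/-! ### The sequence of intersection points along a lift -/

/-- The `m`-th intersection point of `β̃ₛ` with the line `y = 0` after the point `c`. -/
def seqSt (c m : ℕ) : CState := (D.nxt0)^[m] (D.spt c)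

/-- Its label downstairs. -/
def labAt (c m : ℕ) : ℤ := D.lab (D.seqSt c m)

/-- Its position coordinate on the line `y = 0`. -/
def posAt (c m : ℕ) : ℤ := (D.seqSt c m).pos

/-- The differential component carried by the compact arc starting at `k` points
from the starting point of the arc towards its end point.  (For an arc in the upper
half-plane the source of the arrow is the right endpoint, for an arc in the lower
half-plane it is the left endpoint.) -/
def srcIsStart (k : ℕ) : Prop :=
  ¬ (D.TrueUp (D.spt k) ↔ (k : ℤ) < (D.nxt0 (D.spt k)).pos)

/-- The label of the source of the differential component carried by the arc
starting at `k`. -/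
def srcLab (k : ℕ) : ℤ :=
  if D.srcIsStart k then (k : ℤ) % D.pz else (D.nxt0 (D.spt k)).pos % D.pz

/-- The label of the target of the differential component carried by the arc
starting at `k`. -/
def tgtLab (k : ℕ) : ℤ :=
  if D.srcIsStart k then (D.nxt0 (D.spt k)).pos % D.pz else (k : ℤ) % D.pz

/-- The number of bigons (compact arcs) inducing a differential component from `x`
to `y`. -/
def arrowCnt (x y : ℕ) : ℕ :=
  ((Finset.range D.p).filter fun k =>
    D.Returns0 (D.spt k) ∧ D.srcLab k = (x : ℤ) ∧ D.tgtLab k = (y : ℤ)).card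


/-! ### Counting basepoints inside the bigon cut off by a compact arc -/

/-- Doubled plane `x`-coordinate of a state in the (sheared) universal cover. -/
def x2 (σ : CState) : ℤ := 2 * σ.pos - 2 * D.sz * (if σ.top then σ.ht - 1 else σ.ht)

/-- The number of crossings of the upward vertical ray emanating from the basepoint
slot in row `ρ` with doubled `x`-coordinate `X0` (a `w`-slot if `isZ = false`, sitting
just above the line `y = ρ`; a `z`-slot if `isZ = true`, sitting just below the line
`y = ρ + 1`) with the piece of `β̃` between the state `σ` and the next state. -/
def rayCross (σ : CState) (X0 ρ : ℤ) (isZ : Bool) : ℕ :=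
  let σ' := D.fstep σ
  let lo := min (D.x2 σ) (D.x2 σ')
  let hi := max (D.x2 σ) (D.x2 σ')
  if σ.ht ≠ σ'.ht then
    -- a strand crossing the row between the lines `y = min ht` and `y = min ht + 1`
    (if (ρ < min σ.ht σ'.ht ∨ (ρ = min σ.ht σ'.ht ∧ isZ = false)) ∧ lo < X0 ∧ X0 < hi
      then 1 else 0)
  else if σ.top = σ'.top then
    if σ.top then
      -- a rainbow arch hanging below the line `y = σ.ht`
      (if (if isZ then ρ ≤ σ.ht - 2 else ρ ≤ σ.ht - 1) ∧ lo < X0 ∧ X0 < hi then 1 else 0)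
    else
      -- a rainbow arch sitting above the line `y = σ.ht`
      (if (if isZ then ρ ≤ σ.ht - 1 else ρ ≤ σ.ht) ∧ lo < X0 ∧ X0 < hi then 1 else 0)
  else 0

/-- Doubled plane `x`-coordinate of the basepoint slot of row `ρ`, horizontal
translate `m`: the `w`-basepoint is between bottom-edge coordinates `q - 1` and `q`,
the `z`-basepoint between top-edge coordinates `r + q - 1` and `r + q`. -/
def slotX2 (ρ m : ℤ) (isZ : Bool) : ℤ :=
  (if isZ then 2 * (D.rz + D.qz) - 1 else 2 * D.qz - 1) - 2 * ρ * D.sz + 2 * m * D.pz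

/-- The states traversed by the compact arc starting at the intersection point `k`. -/
def arcState (k i : ℕ) : CState := (D.fstep)^[i] (D.spt k)

/-- Number of crossings of the upward vertical ray from a slot with the chord of the
bigon (the segment of the line `y = 0` joining the endpoints of the arc). -/
def chordCross (k : ℕ) (X0 ρ : ℤ) : ℕ :=
  if ρ ≤ -1 ∧ min (D.x2 (D.spt k)) (D.x2 (D.nxt0 (D.spt k))) < X0 ∧
      X0 < max (D.x2 (D.spt k)) (D.x2 (D.nxt0 (D.spt k))) then 1 else 0

/-- A basepoint slot lies inside the (embedded) bigon cobounded by the compact arc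
starting at `k` and the line `y = 0`: the upward vertical ray from the slot meets the
boundary of the bigon an odd number of times. -/
def SlotInBigon (k : ℕ) (ρ m : ℤ) (isZ : Bool) : Prop :=
  ¬ (2 ∣ ((D.chordCross k (D.slotX2 ρ m isZ) ρ : ℤ) +
      ∑ i ∈ Finset.range (D.ret0Steps (D.spt k)),
        (D.rayCross (D.arcState k i) (D.slotX2 ρ m isZ) ρ isZ : ℤ)))

/-- A bound for the rows met by the arc starting at `k`. -/
def hBound (k : ℕ) : ℕ :=
  ((Finset.range (D.ret0Steps (D.spt k) + 1)).sup fun i => (D.arcState k i).ht.natAbs) + 2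

/-- A bound for the horizontal translates of slots met by the arc starting at `k`. -/
def mBound (k : ℕ) : ℕ :=
  ((Finset.range (D.ret0Steps (D.spt k) + 1)).sup fun i => (D.arcState k i).pos.natAbs)
    + (D.hBound k + 2) * (D.s + 1) + D.p + D.q + D.r + 4

/-- The number of lifts of the `w`-basepoint (`isZ = false`), respectively of the
`z`-basepoint (`isZ = true`), inside the bigon cobounded by the compact arc starting
at `k` and the line `y = 0`. -/
def arcBase (k : ℕ) (isZ : Bool) : ℕ :=
  (((Finset.Icc (-(D.hBound k : ℤ)) (D.hBound k)) ×ˢ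
      (Finset.Icc (-(D.mBound k : ℤ)) (D.mBound k))).filter
    fun ρm => D.SlotInBigon k ρm.1 ρm.2 isZ).card

/-- The arc starting at `k` stays within the two rows adjacent to the line `y = 0`
(equivalently, it has height `< 1`). -/
def ArcWithinRow (k : ℕ) : Prop :=
  ∀ n : ℕ, n ≤ D.ret0Steps (D.spt k) → (D.arcState k n).ht = 0

/-- The arc starting at `k` is a lift of a single rainbow arc of the diagram. -/
def ArcIsRainbowLift (k : ℕ) : Prop := D.ret0Steps (D.spt k) = 3

/-! ### Gradings and filtrations of the knot Floer complex -/

/-- The relative Maslov grading changes by `±1` along each arc, dropping (by `1`)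
from the source of its differential component to the target. -/
def grStep (k : ℕ) : ℤ := if D.srcIsStart k then -1 else 1

/-- The relative `i`-filtration drops, from the source of the differential component
carried by an arc to the target, by the number of `w`-basepoints in its bigon. -/
def faStep (k : ℕ) : ℤ := (if D.srcIsStart k then -1 else 1) * (D.arcBase k false : ℤ)

/-- The relative `j`-filtration drops by the number of `z`-basepoints in the bigon. -/
def fbStep (k : ℕ) : ℤ := (if D.srcIsStart k then -1 else 1) * (D.arcBase k true : ℤ)

/-- The sum of the per-arc increments of a relative grading along the first `m` arcs
of the lift `β̃` starting at the point `c`. -/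
def pathSum (f : ℕ → ℤ) (c m : ℕ) : ℤ := ∑ i ∈ Finset.range m, f (D.labAt c i).toNat

/-- `a` occurs in the forward sequence of intersection points of `β̃` with the line
`y = 0` starting at `c`. -/
def ReachIn (c a : ℕ) : Prop := ∃ m : ℕ, D.labAt c m = (a : ℤ)

/-- The value at `a` of the relative grading with per-arc increments `f`, normalised
to vanish at the base point `c` of the class. -/
def relOf (f : ℕ → ℤ) (c a : ℕ) : ℤ :=
  if h : D.ReachIn c a then D.pathSum f c (Nat.find h)
  else if h' : D.ReachIn a c then - D.pathSum f a (Nat.find h') else 0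

/-- The Maslov grading of the generator `a` of the class of `c` (normalised at `c`). -/
def grOf (c a : ℕ) : ℤ := D.relOf D.grStep c a

/-- The `i`-filtration of the generator `a` of the class of `c`. -/
def faOf (c a : ℕ) : ℤ := D.relOf D.faStep c a

/-- The `j`-filtration of the generator `a` of the class of `c`. -/
def fbOf (c a : ℕ) : ℤ := D.relOf D.fbStep c a

/-- The number of generators of the class of `c` in Maslov grading `g`. -/
def grCountClass (c : ℕ) (g : ℤ) : ℕ :=
  ((Finset.range D.p).filter fun a => D.SameClass a c ∧ D.grOf c a = g).card

/-! ### Turning points -/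

/-- The differential component of the arc from the `i`-th to the `(i+1)`-st point of
the sequence along `β̃ₛ` starting at `c` points forward. -/
def srcIsStartAt (c i : ℕ) : Prop := D.srcIsStart (D.labAt c i).toNat

/-- The cumulative relative Maslov grading of the `m`-th point of the sequence along
`β̃ₛ` starting at `c`. -/
def grPartial (c m : ℕ) : ℤ :=
  ∑ i ∈ Finset.range m, (if D.srcIsStartAt c i then (-1 : ℤ) else 1)

/-- The `m`-th point of the sequence along `β̃ₛ` starting at `c` is a *turning point*:
its position on the line `y = 0` is either greater or smaller than the positions of
both its predecessor and its successor. -/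
def TurningAt (c m : ℕ) : Prop :=
  1 ≤ m ∧ ((D.posAt c (m - 1) < D.posAt c m ∧ D.posAt c (m + 1) < D.posAt c m) ∨
    (D.posAt c m < D.posAt c (m - 1) ∧ D.posAt c m < D.posAt c (m + 1)))

/-- A *positive* turning point: its predecessor appears in its differential. -/
def PosTurningAt (c m : ℕ) : Prop := D.TurningAt c m ∧ ¬ D.srcIsStartAt c (m - 1)

/-- A *negative* turning point: it appears in the differential of its predecessor. -/
def NegTurningAt (c m : ℕ) : Prop := D.TurningAt c m ∧ D.srcIsStartAt c (m - 1)

end StdDiagram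

/-! ### Bifiltered complexes over 𝔽₂ -/

/-- A based, bifiltered, Maslov-graded complex over `𝔽₂ = ZMod 2`:  `d x y` is the
coefficient of the basis element `y` in the differential of the basis element `x`,
`gr` is the Maslov grading and `(fa, fb)` the `(i, j)`-bifiltration levels of the
basis elements. -/
structure BFC where
  ι : Type
  fin : Fintype ι
  dec : DecidableEq ι
  d : ι → ι → ZMod 2
  gr : ι → ℤ
  fa : ι → ℤ
  fb : ι → ℤ

attribute [instance] BFC.fin BFC.dec

namespace BFC

/-- The dual of a bifiltered complex. -/
def dual (C : BFC) : BFC :=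
  ⟨C.ι, C.fin, C.dec, fun u v => C.d v u, fun u => - C.gr u, fun u => - C.fa u,
    fun u => - C.fb u⟩

/-- The subcomplex (of a direct summand) spanned by the basis elements selected
by `S`. -/
def sub (C : BFC) (S : C.ι → Bool) : BFC where
  ι := {u : C.ι // S u = true}
  fin := Subtype.fintype _
  dec := Classical.decEq _
  d u v := C.d u.1 v.1
  gr u := C.gr u.1
  fa u := C.fa u.1
  fb u := C.fb u.1

/-- The number of basis elements in Maslov grading `g`. -/
def grCount (C : BFC) (g : ℤ) : ℕ := (Finset.univ.filter fun u : C.ι => C.gr u = g).card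

end BFC

/-- Definition 2.1: a positive staircase with `2N + 1` generators
`y₁, x₁, y₂, x₂, …, y_{N+1}` (even positions along the zigzag are the `y`'s, odd
positions the `x`'s), with `∂ xₗ = yₗ + y_{ℓ+1}`, `∂ yₗ = 0`, where consecutive
generators differ in only one of the two filtration coordinates, alternately. -/
def IsPosStaircaseOf (N : ℕ) (C : BFC) : Prop :=
  ∃ (e : Fin (2 * N + 1) ≃ C.ι) (f : Bool),
    (∀ k l : Fin (2 * N + 1), C.d (e k) (e l) =
      if k.1 % 2 = 1 ∧ (k.1 = l.1 + 1 ∨ l.1 = k.1 + 1) then 1 else 0) ∧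
    (∀ k l : Fin (2 * N + 1), l.1 = k.1 + 1 →
      (C.gr (e l) = C.gr (e k) + (if k.1 % 2 = 0 then 1 else -1)) ∧
      (if decide (k.1 % 2 = 0) = f then
        C.fb (e k) = C.fb (e l) ∧
          (if k.1 % 2 = 0 then C.fa (e k) < C.fa (e l) else C.fa (e l) < C.fa (e k))
      else
        C.fa (e k) = C.fa (e l) ∧
          (if k.1 % 2 = 0 then C.fb (e k) < C.fb (e l) else C.fb (e l) < C.fb (e k))))

/-- A positive staircase (of any length). -/
def IsPosStaircase (C : BFC) : Prop := ∃ N : ℕ, IsPosStaircaseOf N C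

/-- A negative staircase is the dual of a positive staircase. -/
def IsNegStaircase (C : BFC) : Prop := IsPosStaircase C.dual

/-- A staircase: a positive or a negative staircase. -/
def IsStaircase (C : BFC) : Prop := IsPosStaircase C ∨ IsNegStaircase C

/-- A staircase of given sign (`true` = positive). -/
def IsSignedStaircase (b : Bool) (C : BFC) : Prop :=
  if b then IsPosStaircase C else IsNegStaircase C

/-- A box of length 1: generators `a, b, c, d` at bifiltration levels
`(0,0), (0,1), (1,0), (1,1)` (up to an overall shift), with `∂d = b + c`,
`∂b = ∂c = a`, `∂a = 0`. -/
def IsBox (C : BFC) : Prop :=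
  ∃ (e : Fin 4 ≃ C.ι) (a0 b0 g0 : ℤ),
    C.fa (e 0) = a0 ∧ C.fb (e 0) = b0 ∧ C.gr (e 0) = g0 ∧
    C.fa (e 1) = a0 ∧ C.fb (e 1) = b0 + 1 ∧ C.gr (e 1) = g0 + 1 ∧
    C.fa (e 2) = a0 + 1 ∧ C.fb (e 2) = b0 ∧ C.gr (e 2) = g0 + 1 ∧
    C.fa (e 3) = a0 + 1 ∧ C.fb (e 3) = b0 + 1 ∧ C.gr (e 3) = g0 + 2 ∧
    (∀ k l : Fin 4, C.d (e k) (e l) =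
      if (k = 3 ∧ (l = 1 ∨ l = 2)) ∨ ((k = 1 ∨ k = 2) ∧ l = 0) then 1 else 0)

/-- `C` is the direct sum of a complex satisfying `P1` and one satisfying `P2`. -/
def IsDirectSumOf (C : BFC) (P1 P2 : BFC → Prop) : Prop :=
  ∃ S : C.ι → Bool, (∀ u v : C.ι, S u ≠ S v → C.d u v = 0) ∧
    P1 (C.sub S) ∧ P2 (C.sub fun u => ! S u)

/-- Definition 2.3 (a): a positive almost staircase of type (a), with generators
`x₁, …, x_{2k}`, `y₁, …, y_{2k+1}`, `y'_{k+1}` and `z`. -/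
def IsPosAlmostStairA (C : BFC) : Prop :=
  ∃ k : ℕ, 1 ≤ k ∧ ∃ (X Y : ℕ → C.ι) (y' z : C.ι) (a0 b0 : ℤ),
    Fintype.card C.ι = 4 * k + 3 ∧
    (∀ u : C.ι, u = y' ∨ u = z ∨ (∃ ℓ, 1 ≤ ℓ ∧ ℓ ≤ 2 * k ∧ u = X ℓ) ∨
      (∃ ℓ, 1 ≤ ℓ ∧ ℓ ≤ 2 * k + 1 ∧ u = Y ℓ)) ∧
    (∀ u v : C.ι, C.d u v ≠ 0 → C.gr u = C.gr v + 1) ∧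
    C.fa (Y (k + 1)) = a0 ∧ C.fb (Y (k + 1)) = b0 + 1 ∧
    C.fa y' = a0 + 1 ∧ C.fb y' = b0 ∧ C.fa z = a0 ∧ C.fb z = b0 ∧
    (∀ ℓ, 1 ≤ ℓ → ℓ ≤ 2 * k → C.fb (X ℓ) = C.fb (Y ℓ) ∧ C.fa (Y ℓ) < C.fa (X ℓ)) ∧
    (∀ ℓ, 1 ≤ ℓ → ℓ ≤ 2 * k → ℓ ≠ k →
      C.fa (X ℓ) = C.fa (Y (ℓ + 1)) ∧ C.fb (Y (ℓ + 1)) < C.fb (X ℓ)) ∧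
    (C.fa (X k) = C.fa y' ∧ C.fb y' < C.fb (X k)) ∧
    (∀ ℓ, 1 ≤ ℓ → ℓ ≤ 2 * k → ℓ ≠ k → ℓ ≠ k + 1 →
      ∀ v, C.d (X ℓ) v = if v = Y ℓ ∨ v = Y (ℓ + 1) then 1 else 0) ∧
    (∀ v, C.d (X k) v = if v = Y k ∨ v = Y (k + 1) ∨ v = y' then 1 else 0) ∧
    (∀ v, C.d (X (k + 1)) v = if v = Y (k + 1) ∨ v = Y (k + 2) ∨ v = y' then 1 else 0) ∧
    (∀ v, C.d (Y (k + 1)) v = if v = z then 1 else 0) ∧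
    (∀ v, C.d y' v = if v = z then 1 else 0) ∧
    (∀ ℓ, 1 ≤ ℓ → ℓ ≤ 2 * k + 1 → ℓ ≠ k + 1 → ∀ v, C.d (Y ℓ) v = 0) ∧
    (∀ v, C.d z v = 0)

/-- Definition 2.3 (b): a positive almost staircase of type (b), with generators
`x₁, …, x_{2k+1}`, `x'_{k+1}`, `y₁, …, y_{2k+2}` and `z`. -/
def IsPosAlmostStairB (C : BFC) : Prop :=
  ∃ k : ℕ, 1 ≤ k ∧ ∃ (X Y : ℕ → C.ι) (x' z : C.ι) (a0 b0 : ℤ),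
    Fintype.card C.ι = 4 * k + 5 ∧
    (∀ u : C.ι, u = x' ∨ u = z ∨ (∃ ℓ, 1 ≤ ℓ ∧ ℓ ≤ 2 * k + 1 ∧ u = X ℓ) ∨
      (∃ ℓ, 1 ≤ ℓ ∧ ℓ ≤ 2 * k + 2 ∧ u = Y ℓ)) ∧
    (∀ u v : C.ι, C.d u v ≠ 0 → C.gr u = C.gr v + 1) ∧
    C.fa (X (k + 1)) = a0 ∧ C.fb (X (k + 1)) = b0 - 1 ∧
    C.fa x' = a0 - 1 ∧ C.fb x' = b0 ∧ C.fa z = a0 ∧ C.fb z = b0 ∧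
    (∀ ℓ, 1 ≤ ℓ → ℓ ≤ 2 * k + 1 → C.fb (X ℓ) = C.fb (Y ℓ) ∧ C.fa (Y ℓ) < C.fa (X ℓ)) ∧
    (∀ ℓ, 1 ≤ ℓ → ℓ ≤ 2 * k + 1 → ℓ ≠ k + 1 →
      C.fa (X ℓ) = C.fa (Y (ℓ + 1)) ∧ C.fb (Y (ℓ + 1)) < C.fb (X ℓ)) ∧
    (C.fa x' = C.fa (Y (k + 2)) ∧ C.fb (Y (k + 2)) < C.fb x') ∧
    (∀ ℓ, 1 ≤ ℓ → ℓ ≤ 2 * k + 1 → ℓ ≠ k + 1 →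
      ∀ v, C.d (X ℓ) v = if v = Y ℓ ∨ v = Y (ℓ + 1) then 1 else 0) ∧
    (∀ v, C.d z v = if v = X (k + 1) ∨ v = x' then 1 else 0) ∧
    (∀ v, C.d (X (k + 1)) v = if v = Y (k + 1) ∨ v = Y (k + 2) then 1 else 0) ∧
    (∀ v, C.d x' v = if v = Y (k + 1) ∨ v = Y (k + 2) then 1 else 0) ∧
    (∀ ℓ, 1 ≤ ℓ → ℓ ≤ 2 * k + 2 → ∀ v, C.d (Y ℓ) v = 0)

/-- A positive almost staircase. -/
def IsPosAlmostStaircase (C : BFC) : Prop := IsPosAlmostStairA C ∨ IsPosAlmostStairB C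

/-- A negative almost staircase is the dual of a positive almost staircase. -/
def IsNegAlmostStaircase (C : BFC) : Prop := IsPosAlmostStaircase C.dual

/-- `C'` is obtained from `C` by a filtered change of basis: each basis element is
replaced by itself plus a sum of basis elements of the same Maslov grading and of
bifiltration level not higher in either coordinate. -/
def FilteredBasisChange (C C' : BFC) : Prop :=
  ∃ e : C'.ι ≃ C.ι,
    (∀ u, C'.gr u = C.gr (e u)) ∧ (∀ u, C'.fa u = C.fa (e u)) ∧
    (∀ u, C'.fb u = C.fb (e u)) ∧
    ∃ P Q : Matrix C.ι C.ι (ZMod 2),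
      P * Q = 1 ∧ Q * P = 1 ∧ (∀ u, P u u = 1) ∧
      (∀ u v, u ≠ v → P u v ≠ 0 → C.gr u = C.gr v ∧ C.fa v ≤ C.fa u ∧ C.fb v ≤ C.fb u) ∧
      (∀ u v, C'.d u v = (P * Matrix.of C.d * Q) (e u) (e v))

/-- `C` satisfies `P` after some filtered change of basis. -/
def AfterFCB (C : BFC) (P : BFC → Prop) : Prop := ∃ C', FilteredBasisChange C C' ∧ P C'

/-- The knot Floer chain complex `CFK(H, s)` of the standard diagram, in the spin^c
class of the intersection point `c`: it is generated by the intersection points of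
the class of `c`; the coefficient `⟨∂x, y⟩` counts (mod 2) the embedded bigons in
the universal cover cobounded by `α̃` and `β̃ₛ` from a lift of `x` to a lift of `y`;
the relative Maslov grading drops by `1` along each differential, and the relative
`(i, j)`-bifiltration drops according to the number of lifts of the basepoints `w`
and `z` covered by each bigon. -/
def CFK (D : StdDiagram) (c : ℕ) : BFC where
  ι := {a : Fin D.p // D.SameClass a c}
  fin := Subtype.fintype _
  dec := Classical.decEq _
  d x y := (D.arrowCnt x.1 y.1 : ZMod 2)
  gr x := D.grOf c x.1
  fa x := D.faOf c x.1
  fb x := D.fbOf c x.1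


/-- The standard (1,1) diagram with four-tuple `(9, 2, 0, 4)`, representing the knot
`K(9, 2, 0, 4)` of Figure 4 of the paper. -/
def Kexample : StdDiagram := ⟨9, 2, 0, 4, by norm_num, by norm_num, by norm_num⟩

/-- Vertical translation of a state by `c` lifts of `α`. -/
def CState.shift (c : ℤ) (σ : CState) : CState := ⟨σ.pos, σ.up, σ.top, σ.ht + c⟩

theorem CState.shift_shift (a b : ℤ) (σ : CState) :
    (σ.shift a).shift b = σ.shift (a + b) := by
  simp [CState.shift, add_assoc]

namespace StdDiagram

theorem step_shift (D : StdDiagram) (c : ℤ) (σ : CState) :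
    D.step (σ.shift c) = (D.step σ).shift c := by
  grind [step, CState.shift]

theorem stepB_shift (D : StdDiagram) (c : ℤ) (σ : CState) :
    D.stepB (σ.shift c) = (D.stepB σ).shift c := by
  grind [stepB, CState.shift]

/-- If `N` moves of a translation-equivariant map translate `σ` vertically, the whole
trajectory is determined by its first `N` states. -/
theorem iterate_eq_shift {f : CState → CState} {c : ℤ} {σ : CState} {N : ℕ}
    (hf : ∀ a τ, f (CState.shift a τ) = (f τ).shift a)
    (hN : f^[N] σ = σ.shift c) (n : ℕ) :
    f^[n] σ = (f^[n % N] σ).shift (c * (n / N : ℕ)) := by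
  have comm (a : ℤ) (m : ℕ) (τ : CState) : f^[m] (τ.shift a) = (f^[m] τ).shift a :=
    ((show Function.Commute f (CState.shift a) from hf a).iterate_left m) τ
  have key (a : ℕ) : f^[N * a] σ = σ.shift (c * a) := by
    induction a with
    | zero => simp [CState.shift]
    | succ a ih =>
      rw [Nat.mul_succ, Function.iterate_add_apply, hN, comm, ih, CState.shift_shift]
      congr 1
      push_cast
      ring
  conv_lhs => rw [← Nat.mod_add_div n N]
  rw [Function.iterate_add_apply, key, comm]

theorem ret0Steps_eq (D : StdDiagram) {σ : CState} {N : ℕ} (hN : 1 ≤ N)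
    (h : IsCross0 (D.fstep^[N] σ)) (h' : ∀ m < N, 1 ≤ m → ¬ IsCross0 (D.fstep^[m] σ)) :
    D.ret0Steps σ = N := by
  refine IsLeast.csInf_eq ⟨⟨hN, h⟩, fun m hm => ?_⟩
  by_contra! hlt
  exact h' m hlt hm.1 hm.2

end StdDiagram

namespace Kexample

open StdDiagram

theorem upAt_iff (k : ℤ) :
    Kexample.UpAt k ↔ k % 9 = 1 ∨ k % 9 = 3 ∨ k % 9 = 5 ∨ k % 9 = 7 := by
  have period : Kexample.step^[18] start0 = start0.shift (-1) := by rfl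
  have first : ∀ m < 18, (Kexample.step^[m] start0).top = true →
      (Kexample.step^[m] start0).up = true →
      (Kexample.step^[m] start0).pos % 9 = 1 ∨ (Kexample.step^[m] start0).pos % 9 = 3 ∨
      (Kexample.step^[m] start0).pos % 9 = 5 ∨ (Kexample.step^[m] start0).pos % 9 = 7 := by
    decide
  constructor
  · rintro ⟨n, htop, hpos, hup⟩
    rw [iterate_eq_shift Kexample.step_shift period n] at htop hpos hup
    have := first (n % 18) (Nat.mod_lt _ (by norm_num)) htop hup
    change (Kexample.step^[n % 18] start0).pos % 9 = k % 9 at hpos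
    rwa [hpos] at this
  · rintro (h | h | h | h)
    · exact ⟨9, rfl, h.symm, rfl⟩
    · exact ⟨1, rfl, h.symm, rfl⟩
    · exact ⟨11, rfl, h.symm, rfl⟩
    · exact ⟨3, rfl, h.symm, rfl⟩

theorem algInt_eq : Kexample.algInt = -1 := by
  change ∑ k ∈ Finset.range 9, _ = _
  simp [Finset.sum_range_succ, upAt_iff]

theorem fstep_eq : Kexample.fstep = Kexample.stepB := by
  funext σ
  simp [fstep, algInt_eq]

theorem trueUp_iff (σ : CState) : Kexample.TrueUp σ ↔ σ.up = false := by
  simp [TrueUp, algInt_eq]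

theorem trueUpPt_iff (k : ℤ) : Kexample.TrueUpPt k ↔ ¬ Kexample.UpAt k := by
  simp [TrueUpPt, algInt_eq]

theorem spt_eq (k : ℕ) :
    Kexample.spt k = ⟨k, decide (k % 9 = 1 ∨ k % 9 = 3 ∨ k % 9 = 5 ∨ k % 9 = 7), true, 0⟩ := by
  have h : Kexample.UpAt k ↔ (k % 9 = 1 ∨ k % 9 = 3 ∨ k % 9 = 5 ∨ k % 9 = 7) := by
    rw [upAt_iff]
    omega
  by_cases hk : Kexample.UpAt k <;> simp [spt, hk, ← h]

theorem not_returns0_zero : ¬ Kexample.Returns0 (Kexample.spt 0) := by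
  rintro ⟨n, hn, htop, hht⟩
  rw [fstep_eq, spt_eq] at htop hht
  have period : Kexample.stepB^[18] ⟨0, false, true, 0⟩ =
      CState.shift 1 ⟨0, false, true, 0⟩ := by rfl
  have first : ∀ m < 18, 0 ≤ (Kexample.stepB^[m] ⟨0, false, true, 0⟩).ht ∧
      (1 ≤ m → (Kexample.stepB^[m] ⟨0, false, true, 0⟩).top = true →
        (Kexample.stepB^[m] ⟨0, false, true, 0⟩).ht ≠ 0) := by
    decide
  have hit := iterate_eq_shift Kexample.stepB_shift period n
  obtain ⟨hnonneg, hne⟩ := first (n % 18) (Nat.mod_lt _ (by norm_num))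
  have htop' : (Kexample.stepB^[n % 18] ⟨0, false, true, 0⟩).top = true :=
    (congrArg CState.top hit).symm.trans htop
  have hht' : (Kexample.stepB^[n % 18] ⟨0, false, true, 0⟩).ht + 1 * (n / 18 : ℕ) = 0 :=
    (congrArg CState.ht hit).symm.trans hht
  by_cases h : 1 ≤ n % 18
  · have := hne h htop'
    omega
  · omega

theorem returns0_and_nxt0 (k N : ℕ) (σ : CState) (hσ : Kexample.spt k = σ) (hN : 1 ≤ N)
    (h : (Kexample.stepB^[N] σ).top = true ∧ (Kexample.stepB^[N] σ).ht = 0)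
    (h' : ∀ m < N, 1 ≤ m →
      ¬ ((Kexample.stepB^[m] σ).top = true ∧ (Kexample.stepB^[m] σ).ht = 0)) :
    Kexample.Returns0 (Kexample.spt k) ∧
      (Kexample.nxt0 (Kexample.spt k)).pos = (Kexample.stepB^[N] σ).pos := by
  subst hσ
  rw [← fstep_eq] at h h' ⊢
  exact ⟨⟨N, hN, h⟩, by rw [nxt0, ret0Steps_eq _ hN h h']⟩

/-- The number of moves along the arc starting at `k`. -/
def arcLength (k : ℕ) : ℕ := [0, 1, 7, 1, 7, 5, 3, 5, 3].getD k 0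

theorem returns0_and_arcRight_iff (k : ℕ) (h1 : 1 ≤ k) (h9 : k < 9) :
    Kexample.Returns0 (Kexample.spt k) ∧
      (Kexample.ArcRight k ↔ k = 1 ∨ k = 2 ∨ k = 5 ∨ k = 6) := by
  have h := returns0_and_nxt0 k (arcLength k) _ (spt_eq k)
    (by revert k; decide) (by revert k; decide) (by revert k; decide)
  refine ⟨h.1, ?_⟩
  rw [ArcRight, h.2]
  clear h
  revert k
  decide

theorem upperStarts_eq : Kexample.UpperStarts = {2, 4, 6, 8} := by
  ext k
  simp only [UpperStarts, Finset.mem_filter, Finset.mem_range, trueUp_iff]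
  change k < 9 ∧ _ ↔ _
  rcases Nat.eq_zero_or_pos k with rfl | hk
  · simp [not_returns0_zero]
  · by_cases h9 : k < 9
    · rw [and_iff_right h9, and_iff_right (returns0_and_arcRight_iff k hk h9).1, spt_eq]
      interval_cases k <;> simp
    · simp [h9]; omega

theorem lowerStarts_eq : Kexample.LowerStarts = {1, 3, 5, 7} := by
  ext k
  simp only [LowerStarts, Finset.mem_filter, Finset.mem_range, trueUp_iff]
  change k < 9 ∧ _ ↔ _
  rcases Nat.eq_zero_or_pos k with rfl | hk
  · simp [not_returns0_zero]
  · by_cases h9 : k < 9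
    · rw [and_iff_right h9, and_iff_right (returns0_and_arcRight_iff k hk h9).1, spt_eq]
      interval_cases k <;> simp
    · simp [h9]; omega

theorem uCnt_eq (b : Bool) : Kexample.uCnt b = 2 := by
  rw [uCnt, upperStarts_eq]
  cases b <;>
    simp [Finset.filter_insert, Finset.filter_singleton, (returns0_and_arcRight_iff _ _ _).2]

theorem lCnt_eq (b : Bool) : Kexample.lCnt b = 2 := by
  rw [lCnt, lowerStarts_eq]
  cases b <;>
    simp [Finset.filter_insert, Finset.filter_singleton, (returns0_and_arcRight_iff _ _ _).2]

theorem rainbowArcs_eq :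
    Kexample.rainbowArcs = {(true, 0), (true, 1), (false, 0), (false, 1)} := by
  rfl

theorem famCnt_eq (f b : Bool) : Kexample.famCnt f b = 1 := by
  rw [famCnt, rainbowArcs_eq]
  have hs : Kexample.sz = 4 := rfl
  cases f <;> cases b <;>
    simp [Finset.filter_insert, Finset.filter_singleton, rOrientRight, trueUpPt_iff, upAt_iff, hs]

theorem not_shareEnd {a b : Bool × ℕ} (ha : a ∈ Kexample.rainbowArcs)
    (hb : b ∈ Kexample.rainbowArcs) (hab : a ≠ b) : ¬ Kexample.ShareEnd a b := by
  have h : ∀ a ∈ ({(true, 0), (true, 1), (false, 0), (false, 1)} : Finset (Bool × ℕ)),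
      ∀ b ∈ ({(true, 0), (true, 1), (false, 0), (false, 1)} : Finset (Bool × ℕ)), a ≠ b →
      ∀ x ∈ Kexample.rEnds a, x ∉ Kexample.rEnds b := by
    decide
  rw [rainbowArcs_eq] at ha hb
  rintro ⟨x, hx⟩
  rw [Finset.mem_inter] at hx
  exact h a ha b hb hab x hx.1 hx.2

end Kexample

/-- the counterexample `K(9,2,0,4)`.  The standard diagram with
four-tuple `(9, 2, 0, 4)` has exactly two inconsistent rainbow arcs (one around each
basepoint), yet the union of the lifts `β̃ₛ` in the universal cover contains four
inconsistent arcs; in particular the diagram is neither virtually almost coherent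
nor strongly almost coherent. -/
theorem Kexample_not_almost_coherent :
    (∃ dT dB : Bool,
      Kexample.famCnt true dT ≤ Kexample.famCnt true (!dT) ∧
      Kexample.famCnt false dB ≤ Kexample.famCnt false (!dB) ∧
      Kexample.famCnt true dT = 1 ∧ Kexample.famCnt false dB = 1) ∧
    (∃ dU dL : Bool,
      Kexample.uCnt dU ≤ Kexample.uCnt (!dU) ∧
      Kexample.lCnt dL ≤ Kexample.lCnt (!dL) ∧
      Kexample.uCnt dU + Kexample.lCnt dL = 4) ∧
    ¬ Kexample.VirtuallyAlmostCoherent ∧ ¬ Kexample.StronglyAlmostCoherent := by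
  refine ⟨⟨true, true, by simp [Kexample.famCnt_eq]⟩,
    ⟨true, true, by simp [Kexample.uCnt_eq, Kexample.lCnt_eq]⟩, ?_, ?_⟩
  · rintro ⟨dU, dL, -, -, h⟩
    simp [Kexample.uCnt_eq, Kexample.lCnt_eq] at h
  · rintro ⟨dT, dB, -, -, a₁, a₂, hne, hall, hshare⟩
    have h₁ := ((hall a₁).2 (Or.inl rfl)).1
    have h₂ := ((hall a₂).2 (Or.inr rfl)).1
    rcases hshare with h | ⟨b₁, b₂, hb₁, -, hne₁, -, -, -, -, h, -, -⟩
    · exact Kexample.not_shareEnd h₁ h₂ hne h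
    · exact Kexample.not_shareEnd h₁ hb₁ hne₁.symm h

end

end OneOneKnot
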